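/- Let X be a metric space with metric d, let C ∈ X be a fixed point, and let Ĉ_0, Ĉ_1, …, Ĉ_K be points in X. Suppose there exist an index j ∈ {0,…,K}, a constant A > 0, and a nondecreasing function w : {0,…,K} → ℝ≥0 such that d(Ĉ_i, C) ≤ A·w(i) for all i with j ≤ i ≤ K. Define j* := min of the set of indices j' ≤ K−1 such that for all k ∈ {j'+1,…,K}, d(Ĉ_{j'}, Ĉ_k) ≤ 2A·w(k) (with j* := K if the set is empty). Then d(Ĉ_{j*}, C) ≤ 3A·w(j). -/

import Mathlib

open Classical in
theorem lepskii_error_bound {X : Type*} [MetricSpace X]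
    (K : ℕ) (Chat : ℕ → X) (C : X)
    (j : ℕ) (hj : j ≤ K) (A : ℝ) (hA : 0 < A)
    (w : ℕ → ℝ) (hw0 : ∀ i, i ≤ K → 0 ≤ w i)
    (hwmono : ∀ i k, i ≤ k → k ≤ K → w i ≤ w k)
    (hbound : ∀ i, j ≤ i → i ≤ K → dist (Chat i) C ≤ A * w i)
    (S : Set ℕ)
    (hS : S = {j' | j' ≤ K - 1 ∧
      ∀ k, j' + 1 ≤ k → k ≤ K → dist (Chat j') (Chat k) ≤ 2 * A * w k})
    (jstar : ℕ) (hjstar : jstar = if S.Nonempty then sInf S else K) :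
    dist (Chat jstar) C ≤ 3 * A * w j := by
  have mem_of_lt (h : j < K) : j ∈ S := by
    rw [hS]
    refine ⟨by omega, fun k hjk hkK => ?_⟩
    have hw := mul_le_mul_of_nonneg_left (hwmono j k (by omega) hkK) hA.le
    have htri := dist_triangle_right (Chat j) (Chat k) C
    linarith [hbound j le_rfl hj, hbound k (by omega) hkK]
  have hle : jstar ≤ j := by
    rw [hjstar]
    split_ifs with hne
    · rcases hj.lt_or_eq with h | h
      · exact Nat.sInf_le (mem_of_lt h)
      · have hmem := Nat.sInf_mem hne
        have hlast : sInf S ≤ K - 1 := (hS.subset hmem).1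
        omega
    · by_contra! h
      exact hne ⟨j, mem_of_lt h⟩
  have hdist : dist (Chat jstar) (Chat j) ≤ 2 * A * w j := by
    rcases hle.lt_or_eq with h | h
    · have hne : S.Nonempty := by
        by_contra hne
        rw [if_neg hne] at hjstar
        omega
      rw [if_pos hne] at hjstar
      have hmem : jstar ∈ S := hjstar ▸ Nat.sInf_mem hne
      exact (hS.subset hmem).2 j h hj
    · rw [h, dist_self]
      have := hw0 j hj
      positivity
  linarith [dist_triangle (Chat jstar) (Chat j) C, hbound j le_rfl hj]
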